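/- Let m ≥ 1 and β ≥ 1 be integers, l ≥ 1 an integer, and B an l×l matrix over ℤ[t,t⁻¹] each of whose rows sums to zero. Let A be the (2l+1)×(l+1) matrix over ℤ[t,t⁻¹] whose first l rows are the rows of B followed by a zero entry, whose rows l+1,…,2l are given by A_{l+i,j} = 1−t^m if j = i and 0 for other j ≤ l, with last entry A_{l+i,l+1} = t^{−β}−1, and whose last row is (Σ_{k=0}^{m−1} t^{−kβ}, 0, …, 0, t^{−mβ}·Σ_{k=0}^{β−1} t^{km}). Then the determinant of every (l+1)×(l+1) submatrix of A obtained by choosing l+1 of its rows is zero. (This is Lemma 3.1(1) of the paper: the zeroth elementary ideal of the (m,n)-branched twist spin K^{m,n} vanishes, E₀(K^{m,n}) = 0, where B is the Alexander matrix of a Wirtinger presentation of K with t replaced by t^{−β}.) -/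

import Mathlib

/-- The associated `(2l+1) × (l+1)` matrix built from an `l × l` matrix `B` and ring
elements `a, b, c, d`: the first `l` rows are the rows of `B` followed by a `0`; the
next `l` rows are `a` on the diagonal (other entries `0`) with last entry `b`; the
last row is `(c, 0, …, 0, d)`. Rows are indexed by `Fin l ⊕ Fin l ⊕ Unit` and columns
by `Fin l ⊕ Unit`. -/
def assocMatrix {R : Type*} [CommRing R] {l : ℕ} (B : Matrix (Fin l) (Fin l) R)
    (a b c d : R) : Matrix (Fin l ⊕ (Fin l ⊕ Unit)) (Fin l ⊕ Unit) R :=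
  fun i j =>
    match i, j with
    | Sum.inl i, Sum.inl j => B i j
    | Sum.inl _, Sum.inr _ => 0
    | Sum.inr (Sum.inl i), Sum.inl j => if i = j then a else 0
    | Sum.inr (Sum.inl _), Sum.inr _ => b
    | Sum.inr (Sum.inr _), Sum.inl j => if (j : ℕ) = 0 then c else 0
    | Sum.inr (Sum.inr _), Sum.inr _ => d

open LaurentPolynomial

/-- The vector `(b, …, b, -a)` lies in the kernel of the associated matrix when the rows of `B`
sum to zero and `c * b = d * a`. -/
theorem assocMatrix_mulVec_eq_zero {R : Type*} [CommRing R] {l : ℕ} (hl : 1 ≤ l)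
    (B : Matrix (Fin l) (Fin l) R) (hB : ∀ i, ∑ j, B i j = 0) (a b c d : R)
    (h : c * b = d * a) :
    (assocMatrix B a b c d).mulVec (Sum.elim (fun _ => b) (fun _ => -a)) = 0 := by
  funext i
  obtain ⟨n, rfl⟩ : ∃ n, l = n + 1 := ⟨l - 1, by omega⟩
  rcases i with i | i | i
  · simp [Matrix.mulVec, dotProduct, assocMatrix, ← Finset.sum_mul, hB]
  · simp [Matrix.mulVec, dotProduct, assocMatrix, mul_comm]
  · simp [Matrix.mulVec, dotProduct, assocMatrix, h]

/-- Both sides are geometric sums equal to `t^{-mβ} - 1`. -/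
theorem geom_sum_T_mul_eq (m β : ℕ) :
    (∑ k ∈ Finset.range m, T (-((k : ℤ) * β)) : LaurentPolynomial ℤ) * (T (-(β : ℤ)) - 1) =
      (T (-((m : ℤ) * β)) * ∑ k ∈ Finset.range β, T ((k : ℤ) * m)) * (1 - T (m : ℤ)) := by
  have hc := geom_sum_mul (T (-(β : ℤ)) : LaurentPolynomial ℤ) m
  have hd := geom_sum_mul_neg (T (m : ℤ) : LaurentPolynomial ℤ) β
  simp only [T_pow, mul_neg] at hc hd
  rw [hc, mul_assoc, hd, mul_sub, mul_one, ← T_add, mul_comm (β : ℤ) m, neg_add_cancel, T_zero]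

theorem one_sub_T_ne_zero {m : ℤ} (hm : m ≠ 0) : (1 - T m : LaurentPolynomial ℤ) ≠ 0 := by
  intro h
  rw [sub_eq_zero, ← T_zero] at h
  have hdeg := congrArg LaurentPolynomial.degree h
  rw [degree_T, degree_T] at hdeg
  exact hm (by exact_mod_cast hdeg.symm)

/-- Lemma 3.1(1) of the paper: `E₀(K^{m,n}) = 0`. With `a = 1 - t^m`, `b = t^{-β} - 1`,
`c = ∑_{k<m} t^{-kβ}`, `d = t^{-mβ}·∑_{k<β} t^{km}` and `B` an `l × l` matrix over
`ℤ[t,t⁻¹]` whose rows sum to zero, every `(l+1) × (l+1)` submatrix of the associated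
Alexander matrix obtained by choosing `l+1` of its rows has zero determinant. -/
theorem stmt7 (m β : ℕ) (hm : 1 ≤ m) (hβ : 1 ≤ β) {l : ℕ} (hl : 1 ≤ l)
    (B : Matrix (Fin l) (Fin l) (LaurentPolynomial ℤ)) (hB : ∀ i, ∑ j, B i j = 0) :
    ∀ rows : (Fin l ⊕ Unit) → (Fin l ⊕ (Fin l ⊕ Unit)), Function.Injective rows →
      ((assocMatrix B (1 - T (m : ℤ)) (T (-(β : ℤ)) - 1)
          (∑ k ∈ Finset.range m, T (-((k : ℤ) * β)))
          (T (-((m : ℤ) * β)) * ∑ k ∈ Finset.range β, T ((k : ℤ) * m))).submatrix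
        rows id).det = 0 := by
  intro rows _
  rw [← Matrix.exists_mulVec_eq_zero_iff]
  refine ⟨Sum.elim (fun _ => T (-(β : ℤ)) - 1) (fun _ => -(1 - T (m : ℤ))), ?_, ?_⟩
  · intro h
    exact one_sub_T_ne_zero (by omega : (m : ℤ) ≠ 0)
      (neg_eq_zero.mp (congrFun h (Sum.inr ())))
  · funext i
    exact congrFun (assocMatrix_mulVec_eq_zero hl B hB _ _ _ _ (geom_sum_T_mul_eq m β)) (rows i)
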